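/- Let σ be an intertwining permutation (n,s,L) → (n,t,M), and let (n′, s′, L′) be the leaf contraction of (n,s,L) at (i,j). Then the leaf contraction (n′, t′, M′) of (n,t,M) at (σ(j)−j+i, σ(j)) exists (in particular σ maps {i,…,j−1} onto {σ(j)−j+i,…,σ(j)−1} and the hypotheses for leaf contraction at (σ(j)−j+i, σ(j)) hold for (n,t,M)), there is a unique map σ′ : {1,…,n′} → {1,…,n′} satisfying τ_{t,σ(j)−j+i,σ(j)} ∘ σ′ = σ ∘ τ_{s,i,j}, and this σ′ is an intertwining permutation (n′, s′, L′) → (n′, t′, M′). -/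

import Mathlib

def IsTree (n : ℕ) (s : ℕ → ℕ) (L : Finset ℕ) : Prop :=
  L ⊆ Finset.Icc 1 n ∧
  (∀ x ∈ Finset.Icc 1 (n - 1), s x ∈ Finset.Icc 1 n ∧ s x ∉ L) ∧
  (∀ x ∈ Finset.Icc 1 (n - 1), x < s x) ∧
  (∀ x y, x ∈ Finset.Icc 1 (n - 1) → y ∈ Finset.Icc 1 (n - 1) →
    x ≤ y → y < s x → s y ≤ s x)


/-- `σ` is an intertwining permutation `(n,s,L) → (n,t,M)`: a bijection of
`{1,…,n}` (encoded as a permutation of `ℕ` mapping `{1,…,n}` onto itself)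
with `σ n = n`, `σ(L) = M`, and `t (σ i) = σ (s i)` on the domain. -/
def Intertwines (n : ℕ) (s : ℕ → ℕ) (L : Finset ℕ) (t : ℕ → ℕ) (M : Finset ℕ)
    (σ : Equiv.Perm ℕ) : Prop :=
  Set.MapsTo σ (Set.Icc 1 n) (Set.Icc 1 n) ∧
  Set.MapsTo σ.symm (Set.Icc 1 n) (Set.Icc 1 n) ∧
  σ n = n ∧
  L.image σ = M ∧
  ∀ i ∈ Finset.Icc 1 (n - 1), t (σ i) = σ (s i)


/-- The map `τ_{s,i,j} : {1,…,n'} → {1,…,n}` (`n' = n - j + i`), `k ↦ k` for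
`k < i` and `k ↦ k + j - i` for `k ≥ i`; its image is `{1,…,n} ∖ {i,…,j-1}`. -/
def tau2 (i j : ℕ) (x : ℕ) : ℕ := if x < i then x else x + j - i

/-- `(n-j+i, s', L')` is the leaf contraction of the tree `(n, s, L)` at `(i,j)`:
`L' = τ_{s,i,j}⁻¹(L) ∪ {i}` and `τ_{s,i,j}(s' k) = s (τ_{s,i,j} k)` for all `k`
in the domain `{1,…,n-j+i-1}`. -/
def IsLeafContraction (n : ℕ) (s : ℕ → ℕ) (L : Finset ℕ) (i j : ℕ)
    (s' : ℕ → ℕ) (L' : Finset ℕ) : Prop :=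
  IsTree (n - j + i) s' L' ∧
  L' = (Finset.Icc 1 (n - j + i)).filter (fun x => tau2 i j x ∈ L) ∪ {i} ∧
  ∀ x ∈ Finset.Icc 1 (n - j + i - 1), tau2 i j (s' x) = s (tau2 i j x)


/-- A left inverse of `tau2 i j`. -/
def tauInv (i j y : ℕ) : ℕ := if y < i then y else y + i - j

lemma tauInv_tau2 {i j : ℕ} (h : i ≤ j) (x : ℕ) : tauInv i j (tau2 i j x) = x := by
  unfold tauInv tau2; split_ifs <;> omega

lemma tau2_tauInv {i j y : ℕ} (h : ¬(i ≤ y ∧ y < j)) : tau2 i j (tauInv i j y) = y := by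
  unfold tauInv tau2; split_ifs <;> omega

lemma tau2_injective {i j : ℕ} (h : i ≤ j) : Function.Injective (tau2 i j) :=
  Function.LeftInverse.injective (tauInv_tau2 h)

lemma tau2_notMem {i j : ℕ} (x : ℕ) : ¬(i ≤ tau2 i j x ∧ tau2 i j x < j) := by
  unfold tau2; split_ifs <;> omega

lemma tau2_lt_iff {i j : ℕ} (h : i ≤ j) {x y : ℕ} : tau2 i j x < tau2 i j y ↔ x < y := by
  unfold tau2; split_ifs <;> omega

lemma tau2_le_iff {i j : ℕ} (h : i ≤ j) {x y : ℕ} : tau2 i j x ≤ tau2 i j y ↔ x ≤ y := by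
  unfold tau2; split_ifs <;> omega

lemma tau2_self {i j : ℕ} : tau2 i j i = j := by
  unfold tau2; split_ifs <;> omega

lemma tau2_eq_top {n i j : ℕ} (h : i ≤ j) (hj : j ≤ n) : tau2 i j (n - j + i) = n := by
  unfold tau2; split_ifs <;> omega

lemma one_le_tau2_iff {i j : ℕ} (hi : 1 ≤ i) (h : i ≤ j) {x : ℕ} : 1 ≤ tau2 i j x ↔ 1 ≤ x := by
  unfold tau2; split_ifs <;> omega

lemma tau2_le_top_iff {n i j : ℕ} (h : i ≤ j) (hj : j ≤ n) {x : ℕ} :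
    tau2 i j x ≤ n ↔ x ≤ n - j + i := by
  unfold tau2; split_ifs <;> omega

lemma tau2_mem_Icc_pred {n i j : ℕ} (hi : 1 ≤ i) (h : i ≤ j) (hj : j ≤ n) {x : ℕ}
    (hx : x ∈ Finset.Icc 1 (n - j + i - 1)) : tau2 i j x ∈ Finset.Icc 1 (n - 1) := by
  rw [Finset.mem_Icc] at *
  unfold tau2; split_ifs <;> omega

/-- If every child of `c` is a leaf, then the children of `c` form an interval ending at
`c - 1`. -/
lemma IsTree.eq_of_le_of_lt {n : ℕ} {t : ℕ → ℕ} {M : Finset ℕ} (ht : IsTree n t M) {c : ℕ}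
    (hc : c ≤ n) (hleaf : ∀ x ∈ Finset.Icc 1 (n - 1), t x = c → x ∈ M)
    {x : ℕ} (hx : x ∈ Finset.Icc 1 (n - 1)) (hxc : t x = c)
    {z : ℕ} (hxz : x ≤ z) (hzc : z < c) : t z = c := by
  obtain ⟨-, hrange, hlt, hnest⟩ := ht
  induction hk : c - z using Nat.strong_induction_on generalizing z with
  | _ k ih =>
    have hz : z ∈ Finset.Icc 1 (n - 1) := by
      rw [Finset.mem_Icc] at *; omega
    have hle := hnest x z hx hz hxz (hxc ▸ hzc)
    have hzt := hlt z hz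
    by_contra hne
    have htz : t z < c := by omega
    have hparent := ih (c - t z) (by omega) (by omega) htz rfl
    refine (hrange z hz).2 (hleaf _ ?_ hparent)
    rw [Finset.mem_Icc] at *; omega

/-- A finite set of naturals below `c` that is upward closed below `c` is an interval ending at
`c - 1`. -/
lemma Finset.eq_Ico_of_upward_closed {S : Finset ℕ} {c : ℕ} (hlt : ∀ x ∈ S, x < c)
    (hup : ∀ x ∈ S, ∀ z, x ≤ z → z < c → z ∈ S) :
    S = Finset.Ico (c - S.card) c := by
  obtain rfl | hne := S.eq_empty_or_nonempty
  · simp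
  · have hS : S = Finset.Ico (S.min' hne) c := by
      ext z
      rw [Finset.mem_Ico]
      exact ⟨fun hz => ⟨S.min'_le z hz, hlt z hz⟩,
        fun hz => hup _ (S.min'_mem hne) z hz.1 hz.2⟩
    have hm := hlt _ (S.min'_mem hne)
    have hcard : S.card = c - S.min' hne := by
      conv_lhs => rw [hS]
      simp
    rw [hcard, Nat.sub_sub_self hm.le]
    exact hS

/-- Leaf contractions exist. -/
lemma IsTree.exists_isLeafContraction {n : ℕ} {t : ℕ → ℕ} {M : Finset ℕ} (ht : IsTree n t M)
    {i j : ℕ} (hi : 1 ≤ i) (hij : i ≤ j) (hj : j ≤ n)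
    (hpre : ∀ x ∈ Finset.Icc 1 (n - 1), (t x = j ↔ i ≤ x ∧ x < j))
    (hsub : Finset.Icc i (j - 1) ⊆ M) :
    ∃ t' M', IsLeafContraction n t M i j t' M' := by
  obtain ⟨-, hrange, hlt, hnest⟩ := ht
  have htau : ∀ x ∈ Finset.Icc 1 (n - j + i - 1),
      tau2 i j (tauInv i j (t (tau2 i j x))) = t (tau2 i j x) := fun x hx =>
    tau2_tauInv fun h => (hrange _ (tau2_mem_Icc_pred hi hij hj hx)).2
      (hsub (by rw [Finset.mem_Icc]; omega))
  refine ⟨fun x => tauInv i j (t (tau2 i j x)), _, ⟨?_, ?_, ?_, ?_⟩, rfl, htau⟩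
  · intro x
    simp only [Finset.mem_union, Finset.mem_filter, Finset.mem_singleton, Finset.mem_Icc]
    omega
  · intro x hx
    have hx' := tau2_mem_Icc_pred hi hij hj hx
    obtain ⟨hmem, hnot⟩ := hrange _ hx'
    rw [← htau x hx] at hmem hnot
    rw [Finset.mem_Icc, one_le_tau2_iff hi hij, tau2_le_top_iff hij hj] at hmem
    refine ⟨Finset.mem_Icc.2 hmem, ?_⟩
    simp only [Finset.mem_union, Finset.mem_filter, Finset.mem_singleton, not_or]
    refine ⟨fun h => hnot h.2, fun h => ?_⟩
    have h' := htau x hx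
    rw [h, tau2_self] at h'
    exact tau2_notMem x ((hpre _ hx').1 h'.symm)
  · intro x hx
    rw [← tau2_lt_iff hij, htau x hx]
    exact hlt _ (tau2_mem_Icc_pred hi hij hj hx)
  · intro x y hx hy hxy hyx
    rw [← tau2_lt_iff hij, htau x hx] at hyx
    rw [← tau2_le_iff hij, htau x hx, htau y hy]
    exact hnest _ _ (tau2_mem_Icc_pred hi hij hj hx) (tau2_mem_Icc_pred hi hij hj hy)
      ((tau2_le_iff hij).2 hxy) hyx

/-- The permutation induced by `σ` between the complements of two intervals which `σ` maps onto
each other. -/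
def contractPerm (σ : Equiv.Perm ℕ) {i j i' j' : ℕ} (hij : i ≤ j) (hij' : i' ≤ j')
    (h : ∀ x, (i' ≤ σ x ∧ σ x < j') ↔ (i ≤ x ∧ x < j)) : Equiv.Perm ℕ where
  toFun x := tauInv i' j' (σ (tau2 i j x))
  invFun x := tauInv i j (σ.symm (tau2 i' j' x))
  left_inv x := by
    dsimp only
    rw [tau2_tauInv (by rw [h]; exact tau2_notMem x), σ.symm_apply_apply, tauInv_tau2 hij]
  right_inv x := by
    dsimp only
    rw [tau2_tauInv (by rw [← h, σ.apply_symm_apply]; exact tau2_notMem x),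
      σ.apply_symm_apply, tauInv_tau2 hij']

lemma tau2_contractPerm (σ : Equiv.Perm ℕ) {i j i' j' : ℕ} (hij : i ≤ j) (hij' : i' ≤ j')
    (h : ∀ x, (i' ≤ σ x ∧ σ x < j') ↔ (i ≤ x ∧ x < j)) (x : ℕ) :
    tau2 i' j' (contractPerm σ hij hij' h x) = σ (tau2 i j x) :=
  tau2_tauInv (by rw [h]; exact tau2_notMem x)

theorem statement7 (n : ℕ) (s t : ℕ → ℕ) (L M : Finset ℕ) (σ : Equiv.Perm ℕ)
    (hs : IsTree n s L) (ht : IsTree n t M)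
    (hσ : Intertwines n s L t M σ)
    (i j : ℕ) (h1 : 1 ≤ i) (h2 : i ≤ j) (h3 : j ≤ n) (hjL : j ∉ L)
    (hpre : ∀ x ∈ Finset.Icc 1 (n - 1), (s x = j ↔ i ≤ x ∧ x < j))
    (hsub : Finset.Icc i (j - 1) ⊆ L)
    (s' : ℕ → ℕ) (L' : Finset ℕ)
    (hlc : IsLeafContraction n s L i j s' L') :
    ∃ i' : ℕ, i' + j = σ j + i ∧
      1 ≤ i' ∧ i' ≤ σ j ∧ σ j ≤ n ∧ σ j ∉ M ∧
      (∀ x ∈ Finset.Icc 1 (n - 1), (t x = σ j ↔ i' ≤ x ∧ x < σ j)) ∧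
      Finset.Icc i' (σ j - 1) ⊆ M ∧
      (Finset.Icc i (j - 1)).image σ = Finset.Icc i' (σ j - 1) ∧
      ∃ t' : ℕ → ℕ, ∃ M' : Finset ℕ, IsLeafContraction n t M i' (σ j) t' M' ∧
        (∀ f g : ℕ → ℕ,
          (∀ x ∈ Set.Icc 1 (n - j + i), tau2 i' (σ j) (f x) = σ (tau2 i j x)) →
          (∀ x ∈ Set.Icc 1 (n - j + i), tau2 i' (σ j) (g x) = σ (tau2 i j x)) →
          Set.EqOn f g (Set.Icc 1 (n - j + i))) ∧
        ∃ σ' : Equiv.Perm ℕ,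
          (∀ x ∈ Set.Icc 1 (n - j + i), tau2 i' (σ j) (σ' x) = σ (tau2 i j x)) ∧
          Intertwines (n - j + i) s' L' t' M' σ' := by
  obtain ⟨hmap, hmapinv, hσn, himg, hcomm⟩ := hσ
  have hIcc : ∀ x, (1 ≤ σ x ∧ σ x ≤ n) ↔ (1 ≤ x ∧ x ≤ n) := fun x =>
    ⟨fun hx => by simpa using hmapinv hx, fun hx => hmap hx⟩
  have hpred : ∀ x, σ x ∈ Finset.Icc 1 (n - 1) ↔ x ∈ Finset.Icc 1 (n - 1) := by
    intro x
    have hx := hIcc x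
    have hne : σ x = n ↔ x = n := by
      conv_lhs => rw [← hσn]
      exact σ.injective.eq_iff
    simp only [Finset.mem_Icc]
    omega
  have hmem : ∀ x, σ x ∈ M ↔ x ∈ L := fun x => by
    rw [← himg, Finset.mem_image]
    simp
  obtain ⟨hc1, hcn⟩ := (hIcc j).2 ⟨h1.trans h2, h3⟩
  have hchild : ∀ x ∈ Finset.Icc 1 (n - 1), (t (σ x) = σ j ↔ i ≤ x ∧ x < j) := fun x hx => by
    rw [hcomm x hx, σ.injective.eq_iff, hpre x hx]
  have hIco : ∀ x ∈ Finset.Ico i j, x ∈ Finset.Icc 1 (n - 1) := fun x hx => by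
    rw [Finset.mem_Icc]; rw [Finset.mem_Ico] at hx; omega
  have hleaf : ∀ x ∈ Finset.Icc 1 (n - 1), t x = σ j → x ∈ M := by
    intro x hx hxj
    obtain ⟨y, rfl⟩ := σ.surjective x
    have hy := (hchild y ((hpred y).1 hx)).1 hxj
    exact (hmem y).2 (hsub (by rw [Finset.mem_Icc]; omega))
  have hS : (Finset.Ico i j).image σ = Finset.Ico (σ j - (j - i)) (σ j) := by
    have hiff : ∀ x, x ∈ (Finset.Ico i j).image σ ↔ x ∈ Finset.Icc 1 (n - 1) ∧ t x = σ j := by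
      intro x
      obtain ⟨y, rfl⟩ := σ.surjective x
      rw [Finset.mem_image]
      constructor
      · rintro ⟨z, hz, hzy⟩
        obtain rfl := σ.injective hzy
        exact ⟨(hpred z).2 (hIco z hz), (hchild z (hIco z hz)).2 (Finset.mem_Ico.1 hz)⟩
      · rintro ⟨hy, hty⟩
        exact ⟨y, Finset.mem_Ico.2 ((hchild y ((hpred y).1 hy)).1 hty), rfl⟩
    have hcard : ((Finset.Ico i j).image σ).card = j - i := by
      rw [Finset.card_image_of_injective _ σ.injective, Nat.card_Ico]
    rw [← hcard]
    refine Finset.eq_Ico_of_upward_closed (fun x hx => ?_) fun x hx z hxz hzc => ?_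
    · obtain ⟨hx, hxj⟩ := (hiff x).1 hx
      exact hxj ▸ ht.2.2.1 x hx
    · obtain ⟨hx, hxj⟩ := (hiff x).1 hx
      refine (hiff z).2 ⟨?_, ht.eq_of_le_of_lt hcn hleaf hx hxj hxz hzc⟩
      rw [Finset.mem_Icc] at *; omega
  have hlen : j - i < σ j := by
    have hcard := congrArg Finset.card hS
    rw [Finset.card_image_of_injective _ σ.injective, Nat.card_Ico, Nat.card_Ico] at hcard
    by_contra hge
    have h0 : 0 ∈ (Finset.Ico i j).image σ := by
      rw [hS, Finset.mem_Ico]; omega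
    obtain ⟨x, hx, hx0⟩ := Finset.mem_image.1 h0
    have := Finset.mem_Icc.1 ((hpred x).2 (hIco x hx))
    omega
  obtain ⟨i', hi'⟩ : ∃ i', i' = σ j - (j - i) := ⟨_, rfl⟩
  rw [← hi'] at hS
  have hblock : ∀ x, (i' ≤ σ x ∧ σ x < σ j) ↔ (i ≤ x ∧ x < j) := fun x => by
    rw [← Finset.mem_Ico, ← Finset.mem_Ico, ← hS, Finset.mem_image]
    simp
  have hi'1 : 1 ≤ i' := by omega
  have hi'c : i' ≤ σ j := by omega
  have htpre : ∀ x ∈ Finset.Icc 1 (n - 1), (t x = σ j ↔ i' ≤ x ∧ x < σ j) := by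
    intro x hx
    obtain ⟨y, rfl⟩ := σ.surjective x
    rw [hchild y ((hpred y).1 hx), hblock]
  have htsub : Finset.Icc i' (σ j - 1) ⊆ M := fun x hx => by
    rw [Finset.mem_Icc] at hx
    refine hleaf x ?_ ((htpre x ?_).2 ?_) <;> (try rw [Finset.mem_Icc]) <;> omega
  have hIccIco : ∀ {a b : ℕ}, 1 ≤ b → Finset.Icc a (b - 1) = Finset.Ico a b := fun hb => by
    ext x; rw [Finset.mem_Icc, Finset.mem_Ico]; omega
  obtain ⟨t', M', hlc'⟩ := ht.exists_isLeafContraction hi'1 hi'c hcn htpre htsub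
  have hn' : n - σ j + i' = n - j + i := by omega
  refine ⟨i', by omega, hi'1, hi'c, hcn, fun h => hjL ((hmem j).1 h), htpre, htsub,
    by rw [hIccIco (h1.trans h2), hIccIco hc1, hS], t', M', hlc',
    fun f g hf hg x hx => tau2_injective hi'c ((hf x hx).trans (hg x hx).symm),
    contractPerm σ h2 hi'c hblock, fun x _ => tau2_contractPerm σ h2 hi'c hblock x, ?_⟩
  have hτ := tau2_contractPerm σ h2 hi'c hblock
  generalize contractPerm σ h2 hi'c hblock = σ' at hτ
  obtain ⟨-, hL', hs'⟩ := hlc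
  obtain ⟨-, hM', ht'⟩ := hlc'
  rw [hn'] at hM' ht'
  have hIcc' : ∀ x, (1 ≤ σ' x ∧ σ' x ≤ n - j + i) ↔ (1 ≤ x ∧ x ≤ n - j + i) := fun x => by
    rw [← one_le_tau2_iff h1 h2 (x := x), ← tau2_le_top_iff h2 h3 (x := x), ← hIcc, ← hτ,
      one_le_tau2_iff hi'1 hi'c, tau2_le_top_iff hi'c hcn, hn']
  have htop : σ' (n - j + i) = n - j + i := tau2_injective hi'c <| by
    rw [hτ, tau2_eq_top h2 h3, hσn, ← hn', tau2_eq_top hi'c hcn]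
  have hi : σ' i = i' := tau2_injective hi'c <| by rw [hτ, tau2_self, tau2_self]
  refine ⟨fun x hx => (hIcc' x).2 hx, fun x hx => (hIcc' _).1 (by simpa using hx), htop, ?_, ?_⟩
  · ext y
    obtain ⟨x, rfl⟩ := σ'.surjective y
    rw [σ'.injective.mem_finset_image, hL', hM']
    simp only [Finset.mem_union, Finset.mem_filter, Finset.mem_singleton, Finset.mem_Icc]
    rw [hIcc', hτ, hmem, ← hi, σ'.injective.eq_iff]
  · intro k hk
    apply tau2_injective hi'c
    have hσk : σ' k ∈ Finset.Icc 1 (n - j + i - 1) := by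
      have hk' := hIcc' k
      have hne : σ' k = n - j + i ↔ k = n - j + i := by
        conv_lhs => rw [← htop]
        exact σ'.injective.eq_iff
      rw [Finset.mem_Icc] at *; omega
    rw [ht' _ hσk, hτ, hτ, hs' k hk, hcomm _ (tau2_mem_Icc_pred h1 h2 h3 hk)]
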